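/- arXiv:2601.16832 — 12 statements merged into one kernel-verified Lean document; each statement's English description precedes it below -/
import Mathlib

section
/- Let a > 0 be a real number and define f, h : ℝ → ℝ by f(t) = a·(1 − 13a²t)^(−3/26) and h(t) = (1 − 13a²t)^(5/26). Then f(0) = a, h(0) = 1, and for every t < 1/(13a²) one has the derivatives d/dt (f(t)·h(t)²) = −7·f(t)³/(2·h(t)²) and d/dt (h(t)³) = −15·f(t)²/(2·h(t)). -/
open Real Topology Filter Set

/-- Derivative of a real power of an affine function where the base is positive. -/
lemma hasDerivAt_one_sub_mul_rpow {c t : ℝ} (p : ℝ) (hu : 0 < 1 - c * t) :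
    HasDerivAt (fun s => (1 - c * s) ^ p) (-c * p * ((1 - c * t) ^ p / (1 - c * t))) t := by
  have hd : HasDerivAt (fun s : ℝ => 1 - c * s) (-c) t := by
    simpa using ((hasDerivAt_id t).const_mul c).const_sub 1
  simpa [rpow_sub_one hu.ne'] using hd.rpow_const (p := p) (Or.inl hu.ne')

/-- Explicit solution of the Ricci-harmonic flow ODE system on a contact
Calabi–Yau 7-manifold: `f t = a (1 - 13 a² t)^(-3/26)`,
`h t = (1 - 13 a² t)^(5/26)` satisfy the initial conditions and the ODEs
`(f h²)' = -7 f³ / (2 h²)` and `(h³)' = -15 f² / (2 h)` for `t < 1/(13 a²)`. -/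
theorem stmt_0 (a : ℝ) (ha : 0 < a) (f h : ℝ → ℝ)
    (hf : ∀ t, f t = a * (1 - 13 * a ^ 2 * t) ^ ((-3 : ℝ) / 26))
    (hh : ∀ t, h t = (1 - 13 * a ^ 2 * t) ^ ((5 : ℝ) / 26)) :
    f 0 = a ∧ h 0 = 1 ∧
      ∀ t : ℝ, t < 1 / (13 * a ^ 2) →
        HasDerivAt (fun s => f s * (h s) ^ 2)
          (-7 * (f t) ^ 3 / (2 * (h t) ^ 2)) t ∧
        HasDerivAt (fun s => (h s) ^ 3)
          (-15 * (f t) ^ 2 / (2 * h t)) t := by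
  obtain rfl : f = fun t => a * (1 - 13 * a ^ 2 * t) ^ ((-3 : ℝ) / 26) := funext hf
  obtain rfl : h = fun t => (1 - 13 * a ^ 2 * t) ^ ((5 : ℝ) / 26) := funext hh
  refine ⟨by simp, by simp, fun t ht => ?_⟩
  have hu : 0 < 1 - 13 * a ^ 2 * t := by
    rw [lt_div_iff₀ (by positivity)] at ht
    linarith
  have hdf := (hasDerivAt_one_sub_mul_rpow ((-3 : ℝ) / 26) hu).const_mul a
  have hdh := hasDerivAt_one_sub_mul_rpow ((5 : ℝ) / 26) hu
  obtain ⟨y, hy, hyu⟩ : ∃ y : ℝ, 0 < y ∧ 1 - 13 * a ^ 2 * t = y ^ 26 :=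
    ⟨(1 - 13 * a ^ 2 * t) ^ ((1 : ℝ) / 26), rpow_pos_of_pos hu _, by
      rw [← rpow_mul_natCast hu.le]; norm_num⟩
  have hf_pow : (y ^ 26) ^ ((-3 : ℝ) / 26) = (y ^ 3)⁻¹ := by
    rw [← rpow_natCast_mul hy.le, ← rpow_natCast, ← rpow_neg hy.le]; norm_num
  have hh_pow : (y ^ 26) ^ ((5 : ℝ) / 26) = y ^ 5 := by
    rw [← rpow_natCast_mul hy.le, ← rpow_natCast]; norm_num
  constructor
  · refine (hdf.mul (hdh.pow 2)).congr_deriv ?_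
    simp only [Pi.pow_apply, hyu, hf_pow, hh_pow]
    field_simp
    ring
  · refine (hdh.pow 3).congr_deriv ?_
    simp only [hyu, hf_pow, hh_pow]
    field_simp
    ring
end

section
/- Let a > 0, let I ⊆ ℝ be an open interval containing 0, and let f, h : ℝ → ℝ be differentiable on I with f(t) > 0 and h(t) > 0 for all t ∈ I. Suppose f(0) = a, h(0) = 1, and for every t ∈ I, f′(t) = 3·f(t)³/(2·h(t)⁴) and h′(t) = −5·f(t)²/(2·h(t)³). Then f(t) = a·h(t)^(−3/5) for all t ∈ I. -/
open Real Topology Filter Set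

/-- First integral `f = a h^(-3/5)` of the first-order system
`f' = 3 f³/(2 h⁴)`, `h' = -5 f²/(2 h³)` with `f 0 = a`, `h 0 = 1`. -/
theorem stmt_2 (a : ℝ) (ha : 0 < a)
    (I : Set ℝ) (hIopen : IsOpen I) (hIconn : I.OrdConnected) (h0I : (0 : ℝ) ∈ I)
    (f h : ℝ → ℝ)
    (hfpos : ∀ t ∈ I, 0 < f t) (hhpos : ∀ t ∈ I, 0 < h t)
    (hf0 : f 0 = a) (hh0 : h 0 = 1)
    (hf : ∀ t ∈ I, HasDerivAt f (3 * (f t) ^ 3 / (2 * (h t) ^ 4)) t)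
    (hh : ∀ t ∈ I, HasDerivAt h (-5 * (f t) ^ 2 / (2 * (h t) ^ 3)) t) :
    ∀ t ∈ I, f t = a * (h t) ^ ((-3 : ℝ) / 5) := by
  have hderiv : ∀ t ∈ I, HasDerivAt (fun s => log (f s) + 3 / 5 * log (h s)) 0 t := by
    intro t ht
    have hft := (hfpos t ht).ne'
    have hht := (hhpos t ht).ne'
    refine (((hf t ht).log hft).add (((hh t ht).log hht).const_mul (3 / 5))).congr_deriv ?_
    field_simp
    ring
  intro t ht
  have hconst : log (f t) + 3 / 5 * log (h t) = log (f 0) + 3 / 5 * log (h 0) :=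
    hIopen.is_const_of_deriv_eq_zero hIconn.isPreconnected
      (fun s hs => (hderiv s hs).differentiableAt.differentiableWithinAt)
      (fun s hs => (hderiv s hs).deriv) ht h0I
  rw [hf0, hh0, log_one, mul_zero, add_zero] at hconst
  rw [rpow_def_of_pos (hhpos t ht), ← exp_log (hfpos t ht), ← exp_log ha, ← exp_add, ← hconst]
  congr 1
  ring
end

section
/- Let a > 0, K ≥ 0, c₀ > 0, set τ = 1/(13a²), and for t < τ define Λ(t) = (K²·(1 − 13a²t)^(−10/13) + c₀·a⁴·(1 − 13a²t)^(−2))^(1/2). Then Λ(t) tends to +∞ as t tends to τ from below, and there exists a constant C > 0 such that Λ(t) ≥ C/(τ − t) for all t ∈ [0, τ). -/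
open Real Topology Filter Set

/-- Blow-up of the curvature–torsion quantity `Λ` along the Ricci-harmonic flow
solution: `Λ(t) → ∞` as `t → τ⁻` and `Λ(t) ≥ C/(τ - t)` on `[0, τ)`. -/
theorem stmt_4 (a K c₀ : ℝ) (ha : 0 < a) (hK : 0 ≤ K) (hc₀ : 0 < c₀)
    (τ : ℝ) (hτ : τ = 1 / (13 * a ^ 2)) (Λ : ℝ → ℝ)
    (hΛ : ∀ t < τ, Λ t =
      (K ^ 2 * (1 - 13 * a ^ 2 * t) ^ ((-10 : ℝ) / 13) +
        c₀ * a ^ 4 * (1 - 13 * a ^ 2 * t) ^ ((-2 : ℝ))) ^ ((1 : ℝ) / 2)) :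
    Tendsto Λ (𝓝[<] τ) atTop ∧
      ∃ C : ℝ, 0 < C ∧ ∀ t ∈ Set.Ico (0 : ℝ) τ, C / (τ - t) ≤ Λ t := by
  have hbound : ∀ t < τ, √c₀ / 13 / (τ - t) ≤ Λ t := by
    intro t ht
    have hd : 0 < τ - t := sub_pos.mpr ht
    have hbase : 1 - 13 * a ^ 2 * t = 13 * a ^ 2 * (τ - t) := by
      rw [hτ]
      field_simp
    have hpos : 0 < 13 * a ^ 2 * (τ - t) := by positivity
    rw [hΛ t ht, hbase, ← Real.sqrt_eq_rpow]
    apply Real.le_sqrt_of_sq_le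
    have hsq : (√c₀ / 13 / (τ - t)) ^ 2 =
        c₀ * a ^ 4 * (13 * a ^ 2 * (τ - t)) ^ (-2 : ℝ) := by
      rw [Real.rpow_neg hpos.le, Real.rpow_two, div_pow, div_pow, Real.sq_sqrt hc₀.le]
      field_simp
    rw [hsq]
    exact le_add_of_nonneg_left (by positivity)
  have hC : 0 < √c₀ / 13 := by positivity
  refine ⟨?_, √c₀ / 13, hC, fun t ht => hbound t ht.2⟩
  refine tendsto_atTop_mono' (𝓝[<] τ)
    (eventually_nhdsWithin_of_forall fun t ht => hbound t ht) ?_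
  have hsub : Tendsto (fun t => τ - t) (𝓝[<] τ) (𝓝[>] 0) := by
    refine tendsto_nhdsWithin_iff.mpr
      ⟨?_, eventually_nhdsWithin_of_forall fun t ht => Set.mem_Ioi.mpr (sub_pos.mpr ht)⟩
    have hcont : Continuous fun t : ℝ => τ - t := by fun_prop
    simpa using (hcont.tendsto τ).mono_left nhdsWithin_le_nhds
  simpa only [div_eq_mul_inv, Function.comp_apply] using
    (tendsto_inv_nhdsGT_zero.comp hsub).const_mul_atTop hC
end

section
/- Let a > 0, K ≥ 0, c₀ > 0, set τ = 1/(13a²), and for t < τ define Λ(t) = (K²·(1 − 13a²t)^(−10/13) + c₀·a⁴·(1 − 13a²t)^(−2))^(1/2). Then the set {(τ − t)·Λ(t) : t ∈ [0, τ)} is bounded above, i.e. sup_{t ∈ [0,τ)} (τ − t)·Λ(t) < ∞. -/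
open Real Topology Filter Set

/-- Type I singularity: `sup_{t ∈ [0,τ)} (τ - t)·Λ(t) < ∞` for the curvature–torsion
quantity of the explicit Ricci-harmonic flow solution. -/
theorem stmt_5 (a K c₀ : ℝ) (ha : 0 < a) (hK : 0 ≤ K) (hc₀ : 0 < c₀)
    (τ : ℝ) (hτ : τ = 1 / (13 * a ^ 2)) (Λ : ℝ → ℝ)
    (hΛ : ∀ t < τ, Λ t =
      (K ^ 2 * (1 - 13 * a ^ 2 * t) ^ ((-10 : ℝ) / 13) +
        c₀ * a ^ 4 * (1 - 13 * a ^ 2 * t) ^ ((-2 : ℝ))) ^ ((1 : ℝ) / 2)) :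
    BddAbove ((fun t => (τ - t) * Λ t) '' Set.Ico (0 : ℝ) τ) := by
  refine ⟨τ * (K ^ 2 + c₀ * a ^ 4) ^ ((1 : ℝ) / 2), ?_⟩
  rintro _ ⟨t, ⟨ht0, htτ⟩, rfl⟩
  have hτa : τ * (13 * a ^ 2) = 1 := by rw [hτ]; field_simp
  have hτ0 : 0 < τ := by rw [hτ]; positivity
  simp only [hΛ t htτ]
  obtain ⟨u, hu⟩ : ∃ u, u = 1 - 13 * a ^ 2 * t := ⟨_, rfl⟩
  rw [← hu]
  have hτu : τ - t = τ * u := by rw [hu]; linear_combination t * hτa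
  have hu0 : 0 < u := pos_of_mul_pos_right (hτu ▸ sub_pos.mpr htτ) hτ0.le
  have hu1 : u ≤ 1 := by
    rw [hu]
    have : 0 ≤ 13 * a ^ 2 * t := by positivity
    linarith
  have hpow : u ^ ((-10 : ℝ) / 13) ≤ u ^ (-2 : ℝ) :=
    rpow_le_rpow_of_exponent_ge hu0 hu1 (by norm_num)
  rw [hτu, mul_assoc]
  refine mul_le_mul_of_nonneg_left ?_ hτ0.le
  calc u * (K ^ 2 * u ^ ((-10 : ℝ) / 13) + c₀ * a ^ 4 * u ^ (-2 : ℝ)) ^ ((1 : ℝ) / 2)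
      ≤ u * ((K ^ 2 + c₀ * a ^ 4) * u ^ (-2 : ℝ)) ^ ((1 : ℝ) / 2) := by
        rw [add_mul]
        gcongr
    _ = (K ^ 2 + c₀ * a ^ 4) ^ ((1 : ℝ) / 2) := by
        rw [mul_rpow (by positivity) (by positivity), ← rpow_mul hu0.le,
          show (-2 : ℝ) * (1 / 2) = -1 by norm_num, rpow_neg_one, mul_left_comm,
          mul_inv_cancel₀ hu0.ne', mul_one]
end

section
/- Let a > 0 be a real number and define f, h : ℝ → ℝ by f(t) = a·(1 + (25a²/2)t)^(−3/10) and h(t) = (1 + (25a²/2)t)^(1/10). Then f(0) = a, h(0) = 1, and for every t > −2/(25a²) one has the derivatives d/dt (f(t)·h(t)²) = −5·f(t)³/(4·h(t)²) and d/dt (h(t)³) = 15·f(t)²/(4·h(t)). -/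
open Real Topology Filter Set

/-- A negative multiple of an exponent, as the inverse of a natural power. -/
theorem Real.rpow_neg_natCast_div_eq_inv_pow {x : ℝ} (hx : 0 ≤ x) (n : ℕ) (m : ℝ) :
    x ^ (-(n : ℝ) / m) = ((x ^ (1 / m)) ^ n)⁻¹ := by
  rw [← Real.rpow_mul_natCast hx, ← Real.rpow_neg hx]
  congr 1
  ring

/-- The derivative of a real power of the affine function `1 + c * s`. -/
theorem Real.hasDerivAt_one_add_mul_rpow {c t : ℝ} (ht : 0 < 1 + c * t) (p : ℝ) :
    HasDerivAt (fun s => (1 + c * s) ^ p) (c * p * (1 + c * t) ^ (p - 1)) t := by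
  have h : HasDerivAt (fun s => 1 + c * s) c t := by
    simpa using ((hasDerivAt_id t).const_mul c).const_add 1
  exact h.rpow_const (Or.inl ht.ne')

/-- Explicit immortal solution of the Ricci-like flow ODE system:
`f t = a (1 + (25a²/2) t)^(-3/10)`, `h t = (1 + (25a²/2) t)^(1/10)` satisfy
`(f h²)' = -5 f³/(4 h²)` and `(h³)' = 15 f²/(4 h)` for `t > -2/(25 a²)`. -/
theorem stmt_9 (a : ℝ) (ha : 0 < a) (f h : ℝ → ℝ)
    (hf : ∀ t, f t = a * (1 + 25 * a ^ 2 / 2 * t) ^ ((-3 : ℝ) / 10))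
    (hh : ∀ t, h t = (1 + 25 * a ^ 2 / 2 * t) ^ ((1 : ℝ) / 10)) :
    f 0 = a ∧ h 0 = 1 ∧
      ∀ t : ℝ, -2 / (25 * a ^ 2) < t →
        HasDerivAt (fun s => f s * (h s) ^ 2)
          (-5 * (f t) ^ 3 / (4 * (h t) ^ 2)) t ∧
        HasDerivAt (fun s => (h s) ^ 3)
          (15 * (f t) ^ 2 / (4 * h t)) t := by
  obtain rfl : f = fun t => a * (1 + 25 * a ^ 2 / 2 * t) ^ ((-3 : ℝ) / 10) := funext hf
  obtain rfl : h = fun t => (1 + 25 * a ^ 2 / 2 * t) ^ ((1 : ℝ) / 10) := funext hh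
  refine ⟨by simp, by simp, fun t ht => ?_⟩
  have hu : 0 < 1 + 25 * a ^ 2 / 2 * t := by
    rw [div_lt_iff₀ (by positivity)] at ht
    linarith
  have h_deriv := Real.hasDerivAt_one_add_mul_rpow hu (1 / 10)
  have f_deriv := (Real.hasDerivAt_one_add_mul_rpow hu (-3 / 10)).const_mul a
  have e3 := Real.rpow_neg_natCast_div_eq_inv_pow hu.le 3 10
  have e9 := Real.rpow_neg_natCast_div_eq_inv_pow hu.le 9 10
  have e13 := Real.rpow_neg_natCast_div_eq_inv_pow hu.le 13 10
  push_cast at e3 e9 e13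
  rw [show (1 / 10 - 1 : ℝ) = -9 / 10 by norm_num, e9] at h_deriv
  rw [show (-3 / 10 - 1 : ℝ) = -13 / 10 by norm_num, e13] at f_deriv
  have hr := Real.rpow_pos_of_pos hu (1 / 10)
  constructor
  · refine (f_deriv.mul (h_deriv.pow 2)).congr_deriv ?_
    simp only [Pi.pow_apply, e3]
    generalize (1 + 25 * a ^ 2 / 2 * t) ^ (1 / 10 : ℝ) = r at hr ⊢
    field_simp
    push_cast
    ring
  · refine (h_deriv.pow 3).congr_deriv ?_
    simp only [e3]
    generalize (1 + 25 * a ^ 2 / 2 * t) ^ (1 / 10 : ℝ) = r at hr ⊢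
    field_simp
    push_cast
    ring
end

section
/- Let a > 0, let I ⊆ ℝ be an open interval containing 0, and let f, h : ℝ → ℝ be differentiable on I with f(t) > 0 and h(t) > 0 for all t ∈ I. Suppose f(0) = a, h(0) = 1, and for every t ∈ I, d/dt (f(t)·h(t)²) = −5·f(t)³/(4·h(t)²) and d/dt (h(t)³) = 15·f(t)²/(4·h(t)). Then f(t)·h(t)³ = a for all t ∈ I. -/
open Real Topology Filter Set

/-- First integral `f h³ = a` of the Ricci-like flow ODE system
`(f h²)' = -5 f³/(4 h²)`, `(h³)' = 15 f²/(4 h)` with `f 0 = a`, `h 0 = 1`. -/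
theorem stmt_10 (a : ℝ) (ha : 0 < a)
    (I : Set ℝ) (hIopen : IsOpen I) (hIconn : I.OrdConnected) (h0I : (0 : ℝ) ∈ I)
    (f h : ℝ → ℝ)
    (hfpos : ∀ t ∈ I, 0 < f t) (hhpos : ∀ t ∈ I, 0 < h t)
    (hfdiff : DifferentiableOn ℝ f I) (hhdiff : DifferentiableOn ℝ h I)
    (hf0 : f 0 = a) (hh0 : h 0 = 1)
    (heq1 : ∀ t ∈ I, HasDerivAt (fun s => f s * (h s) ^ 2)
      (-5 * (f t) ^ 3 / (4 * (h t) ^ 2)) t)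
    (heq2 : ∀ t ∈ I, HasDerivAt (fun s => (h s) ^ 3)
      (15 * (f t) ^ 2 / (4 * h t)) t) :
    ∀ t ∈ I, f t * (h t) ^ 3 = a := by
  have hderiv : ∀ t ∈ I, HasDerivAt (fun s => f s * (h s) ^ 3) 0 t := by
    intro t ht
    have hf := ((hfdiff t ht).differentiableAt (hIopen.mem_nhds ht)).hasDerivAt
    have hh := ((hhdiff t ht).differentiableAt (hIopen.mem_nhds ht)).hasDerivAt
    have e1 := (hf.fun_mul (hh.fun_pow 2)).unique (heq1 t ht)
    have e2 := (hh.fun_pow 3).unique (heq2 t ht)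
    have hne : h t ≠ 0 := (hhpos t ht).ne'
    refine (hf.fun_mul (hh.fun_pow 3)).congr_deriv ?_
    norm_num at e1 e2 ⊢
    have hcancel : h t * (-(5 * f t ^ 3) / (4 * h t ^ 2))
        + f t / 3 * (15 * f t ^ 2 / (4 * h t)) = 0 := by
      field_simp
      ring
    linear_combination h t * e1 + f t / 3 * e2 + hcancel
  intro t ht
  have hconst := hIopen.is_const_of_deriv_eq_zero hIconn.isPreconnected
    (fun s hs => (hderiv s hs).differentiableAt.differentiableWithinAt)
    (fun s hs => (hderiv s hs).deriv) ht h0I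
  simpa [hf0, hh0] using hconst
end

section
/- Let a > 0, K ≥ 0, c₀ > 0, and for t ≥ 0 define Λ(t) = (K²·(1 + (25a²/2)t)^(−2/5) + c₀·a⁴·(1 + (25a²/2)t)^(−2))^(1/2). If K > 0 then the set {t·Λ(t) : t ≥ 0} is unbounded above, while if K = 0 then sup_{t ≥ 0} t·Λ(t) < ∞. -/
open Real Topology Filter Set

/-- Type of the infinite-time singularity of the Ricci-like flow solution:
Type IIb (`sup t·Λ(t) = ∞`) if `K > 0` and Type III (`sup t·Λ(t) < ∞`) if `K = 0`. -/
theorem stmt_12 (a K c₀ : ℝ) (ha : 0 < a) (hK : 0 ≤ K) (hc₀ : 0 < c₀)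
    (Λ : ℝ → ℝ)
    (hΛ : ∀ t ≥ (0 : ℝ), Λ t =
      (K ^ 2 * (1 + 25 * a ^ 2 / 2 * t) ^ ((-2 : ℝ) / 5) +
        c₀ * a ^ 4 * (1 + 25 * a ^ 2 / 2 * t) ^ ((-2 : ℝ))) ^ ((1 : ℝ) / 2)) :
    (0 < K → ¬ BddAbove ((fun t => t * Λ t) '' Set.Ici (0 : ℝ))) ∧
      (K = 0 → BddAbove ((fun t => t * Λ t) '' Set.Ici (0 : ℝ))) := by
  set b := 25 * a ^ 2 / 2
  have hb : 0 < b := by positivity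
  have hΛ_nonneg : ∀ t ≥ (0 : ℝ), 0 ≤ Λ t := fun t ht => by
    rw [hΛ t ht]; positivity
  have hΛ_sq : ∀ t ≥ (0 : ℝ), Λ t ^ 2 =
      K ^ 2 * (1 + b * t) ^ ((-2 : ℝ) / 5) + c₀ * a ^ 4 * (1 + b * t) ^ (-2 : ℝ) :=
    fun t ht => by
      rw [hΛ t ht, ← Real.sqrt_eq_rpow, Real.sq_sqrt (by positivity)]
  constructor
  · rintro hK_pos ⟨M, hM⟩
    set t := max 1 ((M ^ 2 + 1) * (1 + b) / K ^ 2)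
    have ht_one : 1 ≤ t := le_max_left _ _
    have ht_zero : 0 ≤ t := by linarith
    have ht_large : (M ^ 2 + 1) * (1 + b) ≤ t * K ^ 2 :=
      (div_le_iff₀ (by positivity)).1 (le_max_right _ _)
    have h_le : t * Λ t ≤ M := hM ⟨t, ht_zero, rfl⟩
    have h_sq_le : (t * Λ t) ^ 2 ≤ M ^ 2 :=
      pow_le_pow_left₀ (mul_nonneg ht_zero (hΛ_nonneg t ht_zero)) h_le 2
    have hu : 1 ≤ 1 + b * t := le_add_of_nonneg_right (by positivity)
    have h_inv : ((1 + b) * t)⁻¹ ≤ (1 + b * t) ^ ((-2 : ℝ) / 5) := calc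
      ((1 + b) * t)⁻¹ ≤ (1 + b * t)⁻¹ := by gcongr; linarith
      _ = (1 + b * t) ^ (-1 : ℝ) := (Real.rpow_neg_one _).symm
      _ ≤ _ := Real.rpow_le_rpow_of_exponent_le hu (by norm_num)
    have h_lower : K ^ 2 * ((1 + b) * t)⁻¹ ≤ Λ t ^ 2 := by
      rw [hΛ_sq t ht_zero]
      exact le_add_of_le_of_nonneg (by gcongr) (by positivity)
    have h_growth : M ^ 2 + 1 ≤ (t * Λ t) ^ 2 := calc
      M ^ 2 + 1 ≤ t * K ^ 2 / (1 + b) := (le_div_iff₀ (by positivity)).2 ht_large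
      _ = t ^ 2 * (K ^ 2 * ((1 + b) * t)⁻¹) := by field_simp
      _ ≤ t ^ 2 * Λ t ^ 2 := by gcongr
      _ = (t * Λ t) ^ 2 := (mul_pow _ _ _).symm
    linarith
  · rintro rfl
    refine ⟨√(c₀ * a ^ 4 / b ^ 2), ?_⟩
    rintro _ ⟨t, ht, rfl⟩
    have ht_zero : 0 ≤ t := ht
    refine Real.le_sqrt_of_sq_le ?_
    rw [mul_pow, hΛ_sq t ht_zero, Real.rpow_neg (by positivity), Real.rpow_two,
      le_div_iff₀ (by positivity)]
    have h_ratio : (b * t) ^ 2 * ((1 + b * t) ^ 2)⁻¹ ≤ 1 := by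
      rw [← div_eq_mul_inv]
      refine div_le_one_of_le₀ ?_ (by positivity)
      gcongr
      linarith
    calc _ = c₀ * a ^ 4 * ((b * t) ^ 2 * ((1 + b * t) ^ 2)⁻¹) := by ring
      _ ≤ c₀ * a ^ 4 := mul_le_of_le_one_right (by positivity) h_ratio
end

section
/- Let a > 0 be a real number and define f, h : ℝ → ℝ by f(t) = a·(1 + 15a²t)^(−1/6) and h(t) = (1 + 15a²t)^(1/6). Then f(0) = a, h(0) = 1, and for every t > −1/(15a²) one has the derivatives d/dt (f(t)·h(t)²) = 5·f(t)³/(2·h(t)²) and d/dt (h(t)³) = 15·f(t)²/(2·h(t)). -/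
open Real Topology Filter Set

/-- Explicit immortal solution of the perturbed Ricci-like flow ODE system:
`f t = a (1 + 15 a² t)^(-1/6)`, `h t = (1 + 15 a² t)^(1/6)` satisfy
`(f h²)' = 5 f³/(2 h²)` and `(h³)' = 15 f²/(2 h)` for `t > -1/(15 a²)`. -/
theorem stmt_14 (a : ℝ) (ha : 0 < a) (f h : ℝ → ℝ)
    (hf : ∀ t, f t = a * (1 + 15 * a ^ 2 * t) ^ ((-1 : ℝ) / 6))
    (hh : ∀ t, h t = (1 + 15 * a ^ 2 * t) ^ ((1 : ℝ) / 6)) :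
    f 0 = a ∧ h 0 = 1 ∧
      ∀ t : ℝ, -1 / (15 * a ^ 2) < t →
        HasDerivAt (fun s => f s * (h s) ^ 2)
          (5 * (f t) ^ 3 / (2 * (h t) ^ 2)) t ∧
        HasDerivAt (fun s => (h s) ^ 3)
          (15 * (f t) ^ 2 / (2 * h t)) t := by
  refine ⟨by simp [hf], by simp [hh], fun t ht => ?_⟩
  have base_pos : 0 < 1 + 15 * a ^ 2 * t := by
    rw [div_lt_iff₀ (by positivity)] at ht
    linarith
  have base_deriv : HasDerivAt (fun s => 1 + 15 * a ^ 2 * s) (15 * a ^ 2) t := by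
    simpa using ((hasDerivAt_id t).const_mul (15 * a ^ 2)).const_add 1
  have h_pos : 0 < h t := hh t ▸ rpow_pos_of_pos base_pos _
  have h_pow_six : h t ^ 6 = 1 + 15 * a ^ 2 * t := by
    rw [hh, ← rpow_mul_natCast base_pos.le]
    norm_num
  have f_eq : ∀ s, 0 < 1 + 15 * a ^ 2 * s → f s = a / h s := fun s hs => by
    rw [hf, hh, neg_div, rpow_neg hs.le, ← div_eq_mul_inv]
  have h_deriv : HasDerivAt h (5 * a ^ 2 / (2 * h t ^ 5)) t := by
    have rpow_deriv := base_deriv.rpow_const (p := 1 / 6) (Or.inl base_pos.ne')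
    rw [← funext hh] at rpow_deriv
    refine rpow_deriv.congr_deriv ?_
    rw [rpow_sub_one base_pos.ne', ← hh t, ← h_pow_six]
    field_simp
    norm_num
  constructor
  · have product_eq : (fun s => f s * h s ^ 2) =ᶠ[𝓝 t] fun s => a * h s := by
      filter_upwards [base_deriv.continuousAt.eventually (lt_mem_nhds base_pos)] with s hs
      have : h s ≠ 0 := hh s ▸ (rpow_pos_of_pos hs _).ne'
      rw [f_eq s hs]
      field_simp
    refine HasDerivAt.congr_of_eventuallyEq ?_ product_eq
    refine (h_deriv.const_mul a).congr_deriv ?_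
    rw [f_eq t base_pos]
    field_simp
  · refine (h_deriv.fun_pow 3).congr_deriv ?_
    rw [f_eq t base_pos]
    push_cast
    field_simp
    norm_num
end

section
/- Let a > 0, let I ⊆ ℝ be an open interval containing 0, and let f, h : ℝ → ℝ be differentiable on I with f(t) > 0 and h(t) > 0 for all t ∈ I. Suppose f(0) = a, h(0) = 1, and for every t ∈ I, d/dt (f(t)·h(t)²) = 5·f(t)³/(2·h(t)²) and d/dt (h(t)³) = 15·f(t)²/(2·h(t)). Then f(t)·h(t) = a for all t ∈ I. -/
open Real Topology Filter Set

/-- First integral `f h = a` of the perturbed Ricci-like flow ODE system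
`(f h²)' = 5 f³/(2 h²)`, `(h³)' = 15 f²/(2 h)` with `f 0 = a`, `h 0 = 1`. -/
theorem stmt_15 (a : ℝ) (ha : 0 < a)
    (I : Set ℝ) (hIopen : IsOpen I) (hIconn : I.OrdConnected) (h0I : (0 : ℝ) ∈ I)
    (f h : ℝ → ℝ)
    (hfpos : ∀ t ∈ I, 0 < f t) (hhpos : ∀ t ∈ I, 0 < h t)
    (hfdiff : DifferentiableOn ℝ f I) (hhdiff : DifferentiableOn ℝ h I)
    (hf0 : f 0 = a) (hh0 : h 0 = 1)
    (heq1 : ∀ t ∈ I, HasDerivAt (fun s => f s * (h s) ^ 2)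
      (5 * (f t) ^ 3 / (2 * (h t) ^ 2)) t)
    (heq2 : ∀ t ∈ I, HasDerivAt (fun s => (h s) ^ 3)
      (15 * (f t) ^ 2 / (2 * h t)) t) :
    ∀ t ∈ I, f t * h t = a := by
  have hderiv : ∀ t ∈ I, HasDerivAt (fun s => f s * h s) 0 t := by
    intro t ht
    have hf := (hfdiff.differentiableAt (hIopen.mem_nhds ht)).hasDerivAt
    have hh := (hhdiff.differentiableAt (hIopen.mem_nhds ht)).hasDerivAt
    have h_pos := hhpos t ht
    have e₁ := (hf.mul (hh.pow 2)).unique (heq1 t ht)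
    have e₂ := (hh.pow 3).unique (heq2 t ht)
    simp only [Pi.pow_apply, Nat.cast_ofNat, Nat.add_one_sub_one, pow_one] at e₁ e₂
    have hh' : deriv h t = 5 * f t ^ 2 / (2 * h t ^ 3) := by
      field_simp at e₂ ⊢
      linarith
    have hf' : deriv f t = -(5 * f t ^ 3) / (2 * h t ^ 4) := by
      rw [hh'] at e₁
      field_simp at e₁ ⊢
      linarith
    have hzero : deriv f t * h t + f t * deriv h t = 0 := by
      rw [hf', hh']
      field_simp
      ring
    exact hzero ▸ hf.mul hh
  intro t ht
  have hconst := hIopen.is_const_of_deriv_eq_zero hIconn.isPreconnected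
    (fun s hs => (hderiv s hs).differentiableAt.differentiableWithinAt)
    (fun s hs => (hderiv s hs).deriv) ht h0I
  simpa [hf0, hh0] using hconst
end

section
/- Let a > 0 be a real number and define f, h : ℝ → ℝ by f(t) = a·(1 − (9a²/4)t)^(1/2) and h(t) = (1 − (9a²/4)t)^(1/2). Then f(0) = a, h(0) = 1, and for every t < 4/(9a²) one has the derivatives d/dt (f(t)·h(t)²) = −27·f(t)³/(8·h(t)²) and d/dt (h(t)³) = −27·f(t)²/(8·h(t)). -/
open Real Topology Filter Set

/-- Explicit ancient solution of the negative gradient flow ODE system: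
`f t = a (1 - (9a²/4) t)^(1/2)`, `h t = (1 - (9a²/4) t)^(1/2)` satisfy
`(f h²)' = -27 f³/(8 h²)` and `(h³)' = -27 f²/(8 h)` for `t < 4/(9 a²)`. -/
theorem stmt_16 (a : ℝ) (ha : 0 < a) (f h : ℝ → ℝ)
    (hf : ∀ t, f t = a * (1 - 9 * a ^ 2 / 4 * t) ^ ((1 : ℝ) / 2))
    (hh : ∀ t, h t = (1 - 9 * a ^ 2 / 4 * t) ^ ((1 : ℝ) / 2)) :
    f 0 = a ∧ h 0 = 1 ∧
      ∀ t : ℝ, t < 4 / (9 * a ^ 2) →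
        HasDerivAt (fun s => f s * (h s) ^ 2)
          (-27 * (f t) ^ 3 / (8 * (h t) ^ 2)) t ∧
        HasDerivAt (fun s => (h s) ^ 3)
          (-27 * (f t) ^ 2 / (8 * h t)) t := by
  have hfa : ∀ s, f s = a * h s := fun s => by rw [hf, hh]
  have h_sqrt : h = fun s => √(1 - 9 * a ^ 2 / 4 * s) := by
    funext s
    rw [hh, Real.sqrt_eq_rpow]
  have h_zero : h 0 = 1 := by simp [hh]
  refine ⟨by rw [hfa, h_zero, mul_one], h_zero, fun t ht => ?_⟩
  have base_pos : 0 < 1 - 9 * a ^ 2 / 4 * t := by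
    rw [lt_div_iff₀ (by positivity)] at ht
    linarith
  have h_pos : 0 < h t := by
    rw [h_sqrt]
    exact Real.sqrt_pos.2 base_pos
  have h_deriv : HasDerivAt h (-(9 * a ^ 2 / 4) / (2 * h t)) t := by
    have base_deriv : HasDerivAt (fun s => 1 - 9 * a ^ 2 / 4 * s) (-(9 * a ^ 2 / 4)) t := by
      simpa using ((hasDerivAt_id t).const_mul (9 * a ^ 2 / 4)).const_sub 1
    rw [h_sqrt]
    exact base_deriv.sqrt base_pos.ne'
  have cube_deriv : HasDerivAt (fun s => h s ^ 3) (-27 * f t ^ 2 / (8 * h t)) t := by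
    refine (h_deriv.fun_pow 3).congr_deriv ?_
    rw [hfa]
    field_simp
    norm_num
    ring
  refine ⟨?_, cube_deriv⟩
  have f_eq : (fun s => f s * h s ^ 2) = fun s => a * h s ^ 3 := by
    funext s
    rw [hfa]
    ring
  rw [f_eq]
  refine (cube_deriv.const_mul a).congr_deriv ?_
  rw [hfa]
  field_simp
end

section
/- Let a > 0, let I ⊆ ℝ be an open interval containing 0, and let f, h : ℝ → ℝ be differentiable on I with f(t) > 0 and h(t) > 0 for all t ∈ I. Suppose f(0) = a, h(0) = 1, and for every t ∈ I, d/dt (f(t)·h(t)²) = −27·f(t)³/(8·h(t)²) and d/dt (h(t)³) = −27·f(t)²/(8·h(t)). Then f(t) = a·h(t) for all t ∈ I. -/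
open Real Topology Filter Set

/-- First integral `f = a h` of the negative gradient flow ODE system
`(f h²)' = -27 f³/(8 h²)`, `(h³)' = -27 f²/(8 h)` with `f 0 = a`, `h 0 = 1`. -/
theorem stmt_17 (a : ℝ) (ha : 0 < a)
    (I : Set ℝ) (hIopen : IsOpen I) (hIconn : I.OrdConnected) (h0I : (0 : ℝ) ∈ I)
    (f h : ℝ → ℝ)
    (hfpos : ∀ t ∈ I, 0 < f t) (hhpos : ∀ t ∈ I, 0 < h t)
    (hfdiff : DifferentiableOn ℝ f I) (hhdiff : DifferentiableOn ℝ h I)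
    (hf0 : f 0 = a) (hh0 : h 0 = 1)
    (heq1 : ∀ t ∈ I, HasDerivAt (fun s => f s * (h s) ^ 2)
      (-27 * (f t) ^ 3 / (8 * (h t) ^ 2)) t)
    (heq2 : ∀ t ∈ I, HasDerivAt (fun s => (h s) ^ 3)
      (-27 * (f t) ^ 2 / (8 * h t)) t) :
    ∀ t ∈ I, f t = a * h t := by
  have hderiv : ∀ t ∈ I, HasDerivAt (fun s => f s * (h s) ^ 2 / (h s) ^ 3) 0 t := by
    intro t ht
    have hne : h t ≠ 0 := (hhpos t ht).ne'
    refine ((heq1 t ht).fun_div (heq2 t ht) (pow_ne_zero 3 hne)).congr_deriv ?_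
    field_simp
    ring
  intro t ht
  have hconst : f t * (h t) ^ 2 / (h t) ^ 3 = f 0 * (h 0) ^ 2 / (h 0) ^ 3 :=
    hIopen.is_const_of_deriv_eq_zero hIconn.isPreconnected
      (fun s hs => (hderiv s hs).differentiableAt.differentiableWithinAt)
      (fun s hs => (hderiv s hs).deriv) ht h0I
  have hne : h t ≠ 0 := (hhpos t ht).ne'
  rw [hf0, hh0] at hconst
  field_simp at hconst
  linarith
end

section
/- Let a > 0, K ≥ 0, c₀ > 0, set τ = 4/(9a²), and for t < τ define Λ(t) = (K²·(1 − (9a²/4)t)^(−2/5) + c₀·a⁴·(1 − (9a²/4)t)^(−2))^(1/2). Then Λ(t) tends to +∞ as t tends to τ from below, and sup_{t ∈ [0,τ)} (τ − t)·Λ(t) < ∞. -/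
open Real Topology Filter Set

theorem mul_rpow_neg_two_rpow_half {s C : ℝ} (hs : 0 < s) (hC : 0 ≤ C) :
    (C * s ^ (-2 : ℝ)) ^ ((1 : ℝ) / 2) = √C * s⁻¹ := by
  rw [mul_rpow hC (rpow_nonneg hs.le _), ← rpow_mul hs.le, ← sqrt_eq_rpow]
  norm_num [rpow_neg_one]

theorem le_rpow_half_add {s A C : ℝ} (hs : 0 < s) (hA : 0 ≤ A) (hC : 0 ≤ C) :
    √C * s⁻¹ ≤ (A * s ^ ((-2 : ℝ) / 5) + C * s ^ (-2 : ℝ)) ^ ((1 : ℝ) / 2) := by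
  rw [← mul_rpow_neg_two_rpow_half hs hC]
  refine rpow_le_rpow (by positivity) ?_ (by norm_num)
  have : 0 ≤ A * s ^ ((-2 : ℝ) / 5) := by positivity
  linarith

theorem rpow_half_add_le {s A C : ℝ} (hs : 0 < s) (hs1 : s ≤ 1) (hA : 0 ≤ A) (hC : 0 ≤ C) :
    (A * s ^ ((-2 : ℝ) / 5) + C * s ^ (-2 : ℝ)) ^ ((1 : ℝ) / 2) ≤ √(A + C) * s⁻¹ := by
  rw [← mul_rpow_neg_two_rpow_half hs (add_nonneg hA hC), add_mul]
  refine rpow_le_rpow (by positivity) ?_ (by norm_num)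
  gcongr ?_ + _
  exact mul_le_mul_of_nonneg_left (rpow_le_rpow_of_exponent_ge hs hs1 (by norm_num)) hA

/-- Type I finite-time singularity of the negative gradient flow solution:
`Λ(t) → ∞` as `t → τ⁻` and `sup_{t ∈ [0,τ)} (τ - t)·Λ(t) < ∞`. -/
theorem stmt_18 (a K c₀ : ℝ) (ha : 0 < a) (hK : 0 ≤ K) (hc₀ : 0 < c₀)
    (τ : ℝ) (hτ : τ = 4 / (9 * a ^ 2)) (Λ : ℝ → ℝ)
    (hΛ : ∀ t < τ, Λ t =
      (K ^ 2 * (1 - 9 * a ^ 2 / 4 * t) ^ ((-2 : ℝ) / 5) +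
        c₀ * a ^ 4 * (1 - 9 * a ^ 2 / 4 * t) ^ ((-2 : ℝ))) ^ ((1 : ℝ) / 2)) :
    Tendsto Λ (𝓝[<] τ) atTop ∧
      BddAbove ((fun t => (τ - t) * Λ t) '' Set.Ico (0 : ℝ) τ) := by
  have hτ0 : 0 < τ := hτ ▸ by positivity
  have hsub (t : ℝ) : τ - t = τ * (1 - 9 * a ^ 2 / 4 * t) := by
    rw [hτ]; field_simp
  have hpos {t : ℝ} (ht : t < τ) : 0 < 1 - 9 * a ^ 2 / 4 * t :=
    pos_of_mul_pos_right (hsub t ▸ sub_pos.2 ht) hτ0.le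
  have hC : 0 < c₀ * a ^ 4 := by positivity
  constructor
  · have hlim : Tendsto (fun t : ℝ => 1 - 9 * a ^ 2 / 4 * t) (𝓝[<] τ) (𝓝[>] 0) := by
      refine tendsto_nhdsWithin_iff.2 ⟨?_, eventually_nhdsWithin_of_forall fun t ht => hpos ht⟩
      have hcont : Continuous fun t : ℝ => 1 - 9 * a ^ 2 / 4 * t := by fun_prop
      have hzero : 1 - 9 * a ^ 2 / 4 * τ = 0 := by rw [hτ]; field_simp; ring
      simpa only [hzero] using (hcont.tendsto τ).mono_left nhdsWithin_le_nhds
    refine tendsto_atTop_mono' _ (eventually_nhdsWithin_of_forall fun t ht => ?_)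
      ((tendsto_inv_nhdsGT_zero.comp hlim).const_mul_atTop (sqrt_pos.2 hC))
    rw [hΛ t ht]
    exact le_rpow_half_add (hpos ht) (sq_nonneg K) hC.le
  · refine ⟨τ * √(K ^ 2 + c₀ * a ^ 4), ?_⟩
    rintro _ ⟨t, ⟨ht0, ht⟩, rfl⟩
    have hs := hpos ht
    have hs1 : 1 - 9 * a ^ 2 / 4 * t ≤ 1 := sub_le_self _ (by positivity)
    calc (τ - t) * Λ t
        ≤ (τ - t) * (√(K ^ 2 + c₀ * a ^ 4) * (1 - 9 * a ^ 2 / 4 * t)⁻¹) := by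
          rw [hΛ t ht]
          exact mul_le_mul_of_nonneg_left (rpow_half_add_le hs hs1 (sq_nonneg K) hC.le)
            (sub_nonneg.2 ht.le)
      _ = τ * √(K ^ 2 + c₀ * a ^ 4) := by
          rw [hsub t, mul_comm (√_), mul_assoc, mul_inv_cancel_left₀ hs.ne']
end
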